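/- Let A be a commutative ring and φ: P → Q a morphism of perfect complexes over A. Then the set of primes p ∈ Spec A such that φ ⊗^L_A k(p) is an isomorphism in D(k(p)) is Zariski open. -/

import Mathlib

open CategoryTheory Limits MonoidalCategory HomologicalComplex

section Defs

variable (R : Type) [CommRing R]

/-- Degreewise tensor of a cochain complex with a module. -/
noncomputable def tensorComplex (F : CochainComplex (ModuleCat.{0} R) ℤ) (K : ModuleCat.{0} R) :
    CochainComplex (ModuleCat.{0} R) ℤ :=
  ((tensorRight K).mapHomologicalComplex _).obj F

/-- The complex vanishes in all sufficiently large degrees. -/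
def IsBoundedAbove (F : CochainComplex (ModuleCat.{0} R) ℤ) : Prop :=
  ∃ N : ℤ, ∀ i > N, IsZero (F.X i)

/-- The complex vanishes outside a bounded range of degrees. -/
def IsBoundedC (F : CochainComplex (ModuleCat.{0} R) ℤ) : Prop :=
  ∃ m N : ℤ, ∀ i : ℤ, (i < m ∨ N < i) → IsZero (F.X i)

def DegreewiseFGFree (F : CochainComplex (ModuleCat.{0} R) ℤ) : Prop :=
  ∀ i : ℤ, Module.Finite R (F.X i) ∧ Module.Free R (F.X i)

def DegreewiseFGProj (F : CochainComplex (ModuleCat.{0} R) ℤ) : Prop :=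
  ∀ i : ℤ, Module.Finite R (F.X i) ∧ Module.Projective R (F.X i)

/-- A strictly perfect complex: bounded and degreewise finitely generated projective. -/
def IsPerfectData (F : CochainComplex (ModuleCat.{0} R) ℤ) : Prop :=
  IsBoundedC R F ∧ DegreewiseFGProj R F

/-- Tor-amplitude in `[a,b]` for a complex of projective (hence flat) modules, where the
underived degreewise tensor computes the derived tensor: for every module `K`, the homology
of `F ⊗ K` is concentrated in degrees `[a,b]`. -/
def TorAmpPlain (F : CochainComplex (ModuleCat.{0} R) ℤ) (a b : ℤ) : Prop :=
  ∀ (K : ModuleCat.{0} R) (i : ℤ), (i < a ∨ b < i) → IsZero ((tensorComplex R F K).homology i)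

/-- Tor-amplitude in `[a,b]` for an arbitrary complex, tested on every bounded-above
degreewise-projective resolution (such a resolution computes the derived tensor product). -/
def TorAmp (F : CochainComplex (ModuleCat.{0} R) ℤ) (a b : ℤ) : Prop :=
  ∀ (P : CochainComplex (ModuleCat.{0} R) ℤ) (f : P ⟶ F),
    IsBoundedAbove R P → (∀ i : ℤ, Module.Projective R (P.X i)) → QuasiIso f →
      TorAmpPlain R P a b

/-- A complex is pseudo-coherent if it admits a quasi-isomorphism from a bounded-above
complex of finitely generated free modules. -/
def PseudoCoherent (F : CochainComplex (ModuleCat.{0} R) ℤ) : Prop :=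
  ∃ (P : CochainComplex (ModuleCat.{0} R) ℤ) (f : P ⟶ F),
    IsBoundedAbove R P ∧ DegreewiseFGFree R P ∧ QuasiIso f

/-- A complex is `n`-pseudo-coherent if it admits a map from a bounded complex of finitely
generated free modules which is an isomorphism on cohomology in degrees `> n` and a
surjection in degree `n`. -/
def NPseudoCoherent (n : ℤ) (F : CochainComplex (ModuleCat.{0} R) ℤ) : Prop :=
  ∃ (P : CochainComplex (ModuleCat.{0} R) ℤ) (f : P ⟶ F),
    IsBoundedC R P ∧ DegreewiseFGFree R P ∧
      (∀ i > n, IsIso (homologyMap f i)) ∧ Epi (homologyMap f n)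

end Defs


/-- The residue field of `A` at a prime `p`. -/
noncomputable abbrev kappa (A : Type) [CommRing A] (p : PrimeSpectrum A) : Type :=
  IsLocalRing.ResidueField (Localization.AtPrime p.asIdeal)

open TensorProduct

/-- A map out of the base change of a finite projective module to a field of fractions of a
quotient of `A` descends to `A` up to a nonzero scalar. -/
lemma exists_baseChange_eq_smul {A K N M : Type*} [CommRing A] [Field K] [Algebra A K]
    [AddCommGroup N] [Module A N] [AddCommGroup M] [Module A M]
    [Module.Finite A N] [Module.Projective A N]
    (hK : ∀ c : K, ∃ a b : A, algebraMap A K b ≠ 0 ∧ b • c = algebraMap A K a)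
    (g : K ⊗[A] N →ₗ[K] K ⊗[A] M) :
    ∃ b : A, algebraMap A K b ≠ 0 ∧ ∃ s : N →ₗ[A] M,
      s.baseChange K = algebraMap A K b • g := by
  classical
  let ι : M →ₗ[A] K ⊗[A] M := TensorProduct.mk A K M 1
  let j : N →ₗ[A] K ⊗[A] N := TensorProduct.mk A K N 1
  let h : N →ₗ[A] K ⊗[A] M := g.restrictScalars A ∘ₗ j
  have clear_denominator (y : K ⊗[A] M) :
      ∃ b : A, algebraMap A K b ≠ 0 ∧ b • y ∈ LinearMap.range ι := by
    induction y with
    | zero => exact ⟨1, by simp, by simp⟩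
    | tmul c m =>
      obtain ⟨a, b, hb, hab⟩ := hK c
      refine ⟨b, hb, a • m, ?_⟩
      rw [TensorProduct.smul_tmul', hab, Algebra.algebraMap_eq_smul_one, TensorProduct.smul_tmul]
      rfl
    | add x y hx hy =>
      obtain ⟨b, hb, hbx⟩ := hx
      obtain ⟨b', hb', hby⟩ := hy
      refine ⟨b * b', by simp [hb, hb'], ?_⟩
      rw [smul_add]
      refine add_mem ?_ ?_
      · rw [mul_comm, mul_smul]
        exact Submodule.smul_mem _ _ hbx
      · rw [mul_smul]
        exact Submodule.smul_mem _ _ hby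
  choose d hd hdmem using clear_denominator
  obtain ⟨T, hT⟩ := Module.Finite.fg_top (R := A) (M := N)
  let b : A := ∏ x ∈ T, d (h x)
  have hb : algebraMap A K b ≠ 0 := by
    rw [map_prod]
    exact Finset.prod_ne_zero_iff.mpr fun x _ => hd _
  have hmem (x : N) : (b • h) x ∈ LinearMap.range ι := by
    have hle : Submodule.span A (T : Set N) ≤ (LinearMap.range ι).comap (b • h) := by
      rw [Submodule.span_le]
      intro x hx
      obtain ⟨c, hc⟩ := Finset.dvd_prod_of_mem (fun x => d (h x)) hx
      change b • h x ∈ LinearMap.range ι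
      have hbc : b = c * d (h x) := by rw [mul_comm]; exact hc
      rw [hbc, mul_smul]
      exact Submodule.smul_mem _ _ (hdmem _)
    exact hle (hT ▸ Submodule.mem_top)
  obtain ⟨s, hs⟩ := Module.projective_lifting_property ι.rangeRestrict
    ((b • h).codRestrict (LinearMap.range ι) hmem) ι.surjective_rangeRestrict
  refine ⟨b, hb, s, ?_⟩
  ext x
  have hx : ι (s x) = b • h x := congrArg Subtype.val (LinearMap.congr_fun hs x)
  simpa [ι, h, j] using hx

/-- An exact sequence of vector spaces admits a partial contracting homotopy. -/
lemma Function.Exact.exists_comp_add_comp_eq_id {K M N L : Type*} [Field K]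
    [AddCommGroup M] [Module K M] [AddCommGroup N] [Module K N] [AddCommGroup L] [Module K L]
    {f : M →ₗ[K] N} {g : N →ₗ[K] L} (h : Function.Exact f g) :
    ∃ (s : N →ₗ[K] M) (t : L →ₗ[K] N), f ∘ₗ s + t ∘ₗ g = LinearMap.id := by
  obtain ⟨r, hr⟩ := g.rangeRestrict.exists_rightInverse_of_surjective g.range_rangeRestrict
  obtain ⟨t, ht⟩ := r.exists_extend
  have hgt (x : N) : g (t (g x)) = g x := by
    have h₁ : t (g x) = r (g.rangeRestrict x) := LinearMap.congr_fun ht (g.rangeRestrict x)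
    rw [h₁]
    exact congrArg Subtype.val (LinearMap.congr_fun hr (g.rangeRestrict x))
  have hmem (x : N) : (LinearMap.id - t ∘ₗ g : N →ₗ[K] N) x ∈ LinearMap.range f :=
    (h _).mp (by simp [hgt])
  obtain ⟨s, hs⟩ := Module.projective_lifting_property f.rangeRestrict
    ((LinearMap.id - t ∘ₗ g : N →ₗ[K] N).codRestrict _ hmem) f.surjective_rangeRestrict
  refine ⟨s, t, LinearMap.ext fun x => ?_⟩
  have hx : f (s x) = x - t (g x) := congrArg Subtype.val (LinearMap.congr_fun hs x)
  simp [hx]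

/-- A zero sequence of finite-dimensional vector spaces is exact as soon as some null-homotopic
endomorphism of the middle term is surjective. -/
lemma Function.Exact.of_surjective_comp_add_comp {K M N L : Type*} [Field K]
    [AddCommGroup M] [Module K M] [AddCommGroup N] [Module K N] [AddCommGroup L] [Module K L]
    [Module.Finite K N] {f : M →ₗ[K] N} {g : N →ₗ[K] L} (hgf : g ∘ₗ f = 0)
    (s : N →ₗ[K] M) (t : L →ₗ[K] N) (hst : Function.Surjective (f ∘ₗ s + t ∘ₗ g)) :
    Function.Exact f g := by
  have hgf' (x : M) : g (f x) = 0 := LinearMap.congr_fun hgf x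
  set e : N →ₗ[K] N := f ∘ₗ s + t ∘ₗ g with he
  have hinj : Function.Injective e := LinearMap.injective_iff_surjective.mpr hst
  have hker (x : N) (hx : x ∈ LinearMap.ker g) : e x ∈ LinearMap.ker g := by
    rw [LinearMap.mem_ker] at hx ⊢
    simp [he, hx, hgf']
  have hsurj : Function.Surjective (e.restrict hker) :=
    LinearMap.injective_iff_surjective.mp fun x y hxy =>
      Subtype.ext (hinj (congrArg Subtype.val hxy))
  refine fun y => ⟨fun hy => ?_, ?_⟩
  · obtain ⟨⟨x, hx⟩, hxy⟩ := hsurj ⟨y, hy⟩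
    have hxy' : e x = y := congrArg Subtype.val hxy
    rw [LinearMap.mem_ker] at hx
    exact ⟨s x, by simpa [he, hx] using hxy'⟩
  · rintro ⟨x, rfl⟩
    exact hgf' x

lemma exact_baseChange_iff_exists_surjective {A K M N L : Type*} [CommRing A] [Field K]
    [Algebra A K] [AddCommGroup M] [Module A M] [AddCommGroup N] [Module A N]
    [AddCommGroup L] [Module A L] [Module.Finite A N] [Module.Projective A N]
    [Module.Finite A L] [Module.Projective A L]
    (hK : ∀ c : K, ∃ a b : A, algebraMap A K b ≠ 0 ∧ b • c = algebraMap A K a)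
    {f : M →ₗ[A] N} {g : N →ₗ[A] L} (hgf : g ∘ₗ f = 0) :
    Function.Exact (f.baseChange K) (g.baseChange K) ↔
      ∃ (s : N →ₗ[A] M) (t : L →ₗ[A] N),
        Function.Surjective ((f ∘ₗ s + t ∘ₗ g).baseChange K) := by
  constructor
  · intro h
    obtain ⟨s', t', hst⟩ := h.exists_comp_add_comp_eq_id
    obtain ⟨b, hb, s, hs⟩ := exists_baseChange_eq_smul hK s'
    obtain ⟨c, hc, t, ht⟩ := exists_baseChange_eq_smul hK t'
    refine ⟨c • s, b • t, ?_⟩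
    have key : (f ∘ₗ (c • s) + (b • t) ∘ₗ g).baseChange K =
        (algebraMap A K b * algebraMap A K c) • LinearMap.id := by
      rw [← hst, LinearMap.baseChange_add, LinearMap.baseChange_comp, LinearMap.baseChange_comp,
        LinearMap.baseChange_smul, LinearMap.baseChange_smul, hs, ht]
      ext x
      have hA (a : A) (y : K ⊗[A] N) : a • y = algebraMap A K a • y := (algebraMap_smul K a y).symm
      simp [hA, smul_smul, mul_comm, -algebraMap_smul]
    rw [key]
    exact fun y => ⟨(algebraMap A K b * algebraMap A K c)⁻¹ • y, by
      rw [LinearMap.smul_apply, LinearMap.id_apply, smul_inv_smul₀ (mul_ne_zero hb hc)]⟩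
  · rintro ⟨s, t, hst⟩
    rw [LinearMap.baseChange_add, LinearMap.baseChange_comp, LinearMap.baseChange_comp] at hst
    exact .of_surjective_comp_add_comp
      (by rw [← LinearMap.baseChange_comp, hgf, LinearMap.baseChange_zero]) _ _ hst

lemma isOpen_setOf_surjective_baseChange_residueField {A M N : Type*} [CommRing A]
    [AddCommGroup M] [Module A M] [AddCommGroup N] [Module A N] [Module.Finite A N]
    (e : M →ₗ[A] N) :
    IsOpen {p : PrimeSpectrum A |
      Function.Surjective (e.baseChange p.asIdeal.ResidueField)} := by
  have heq : {p : PrimeSpectrum A | Function.Surjective (e.baseChange p.asIdeal.ResidueField)} =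
      (Module.support A (N ⧸ LinearMap.range e))ᶜ := by
    ext p
    rw [Set.mem_compl_iff, Module.mem_support_iff_nontrivial_residueField_tensorProduct,
      not_nontrivial_iff_subsingleton, Set.mem_ofPred_eq]
    have hexact := lTensor_exact p.asIdeal.ResidueField (LinearMap.exact_map_mkQ_range e)
      (Submodule.mkQ_surjective _)
    have hsurj := LinearMap.lTensor_surjective p.asIdeal.ResidueField
      (Submodule.mkQ_surjective (LinearMap.range e))
    constructor
    · refine fun h => subsingleton_of_forall_eq 0 fun y => ?_
      obtain ⟨x, rfl⟩ := hsurj y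
      exact (hexact x).mpr (h x)
    · exact fun h y => (hexact y).mp (Subsingleton.elim _ _)
  rw [heq]
  exact Module.isClosed_support.isOpen_compl

lemma Ideal.ResidueField.exists_smul_eq_algebraMap {A : Type*} [CommRing A] (p : Ideal A)
    [p.IsPrime] (c : p.ResidueField) :
    ∃ a b : A, algebraMap A p.ResidueField b ≠ 0 ∧ b • c = algebraMap A p.ResidueField a := by
  obtain ⟨x, y, hy, rfl⟩ := IsFractionRing.div_surjective (A := A ⧸ p) c
  obtain ⟨a, rfl⟩ := Ideal.Quotient.mk_surjective x
  obtain ⟨b, rfl⟩ := Ideal.Quotient.mk_surjective y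
  have hb : algebraMap A p.ResidueField b ≠ 0 := by
    rw [Ne, Ideal.algebraMap_residueField_eq_zero, ← Ideal.Quotient.eq_zero_iff_mem]
    exact nonZeroDivisors.ne_zero hy
  refine ⟨a, b, hb, ?_⟩
  rw [Algebra.smul_def, Ideal.algebraMap_quotient_residueField_mk,
    Ideal.algebraMap_quotient_residueField_mk, mul_div_cancel₀ _ hb]

lemma isOpen_setOf_exact_baseChange_residueField {A M N L : Type*} [CommRing A]
    [AddCommGroup M] [Module A M] [AddCommGroup N] [Module A N] [AddCommGroup L] [Module A L]
    [Module.Finite A N] [Module.Projective A N] [Module.Finite A L] [Module.Projective A L]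
    {f : M →ₗ[A] N} {g : N →ₗ[A] L} (hgf : g ∘ₗ f = 0) :
    IsOpen {p : PrimeSpectrum A | Function.Exact (f.baseChange p.asIdeal.ResidueField)
      (g.baseChange p.asIdeal.ResidueField)} := by
  simp_rw [exact_baseChange_iff_exists_surjective
    (Ideal.ResidueField.exists_smul_eq_algebraMap _) hgf, Set.ofPred_exists]
  exact isOpen_iUnion fun s => isOpen_iUnion fun t =>
    isOpen_setOf_surjective_baseChange_residueField _

lemma ModuleCat.function_exact_extendScalars_map_iff {A K : Type} [CommRing A] [CommRing K]
    [Algebra A K] {M N L : ModuleCat.{0} A} (f : M ⟶ N) (g : N ⟶ L) :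
    Function.Exact ((ModuleCat.extendScalars (algebraMap A K)).map f)
        ((ModuleCat.extendScalars (algebraMap A K)).map g) ↔
      Function.Exact (f.hom.baseChange K) (g.hom.baseChange K) := by
  have h : (algebraMap A K).toAlgebra = ‹Algebra A K› := Algebra.algebra_ext _ _ fun _ => rfl
  conv_rhs => rw [← h]
  exact Iff.rfl

lemma CochainComplex.quasiIso_iff_acyclic_mappingCone {C : Type*} [Category* C] [Abelian C]
    {P Q : CochainComplex C ℤ} (φ : P ⟶ Q) :
    QuasiIso φ ↔ (CochainComplex.mappingCone φ).Acyclic := by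
  rw [← HomologicalComplex.mem_quasiIso_iff, ← HomotopyCategory.quotient_map_mem_quasiIso_iff,
    HomotopyCategory.quasiIso_eq_trW_subcategoryAcyclic,
    ← HomotopyCategory.quotient_obj_mem_subcategoryAcyclic_iff_acyclic]
  exact (HomotopyCategory.subcategoryAcyclic C).trW_iff_of_distinguished _
    (HomotopyCategory.mappingCone_triangleh_distinguished φ)

lemma IsPerfectData.mappingCone {A : Type} [CommRing A]
    {P Q : CochainComplex (ModuleCat.{0} A) ℤ} (hP : IsPerfectData A P) (hQ : IsPerfectData A Q)
    (φ : P ⟶ Q) : IsPerfectData A (CochainComplex.mappingCone φ) := by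
  obtain ⟨⟨m, n, hmn⟩, hP⟩ := hP
  obtain ⟨⟨m', n', hmn'⟩, hQ⟩ := hQ
  refine ⟨⟨min (m - 1) m', max n n', fun i hi => ?_⟩, fun i => ?_⟩
  · rw [CochainComplex.mappingCone.isZero_X_iff]
    exact ⟨hmn _ (by omega), hmn' _ (by omega)⟩
  · have e : (P.X (i + 1) × Q.X i) ≃ₗ[A] (CochainComplex.mappingCone φ).X i :=
      (homotopyCofiber.XIsoBiprod φ i (i + 1) rfl ≪≫
        ModuleCat.biprodIsoProd _ _).symm.toLinearEquiv
    have := (hP (i + 1)).1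
    have := (hP (i + 1)).2
    have := (hQ i).1
    have := (hQ i).2
    exact ⟨Module.Finite.equiv e, Module.Projective.of_equiv e⟩

/-- The locus where a strictly perfect complex has acyclic fiber is open. -/
lemma IsPerfectData.isOpen_setOf_acyclic_extendScalars {A : Type} [CommRing A]
    {F : CochainComplex (ModuleCat.{0} A) ℤ} (hF : IsPerfectData A F) :
    IsOpen {p : PrimeSpectrum A | (((ModuleCat.extendScalars
      (algebraMap A (kappa A p))).mapHomologicalComplex _).obj F).Acyclic} := by
  obtain ⟨⟨m, n, hmn⟩, hF⟩ := hF
  have heq : {p : PrimeSpectrum A | (((ModuleCat.extendScalars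
      (algebraMap A (kappa A p))).mapHomologicalComplex _).obj F).Acyclic} =
      ⋂ i ∈ Set.Icc m n, {p : PrimeSpectrum A |
        Function.Exact ((F.d (i - 1) i).hom.baseChange p.asIdeal.ResidueField)
          ((F.d i (i + 1)).hom.baseChange p.asIdeal.ResidueField)} := by
    ext p
    simp only [Set.mem_iInter, Set.mem_ofPred_eq]
    have hiff (i : ℤ) : (((ModuleCat.extendScalars
        (algebraMap A (kappa A p))).mapHomologicalComplex _).obj F).ExactAt i ↔
        Function.Exact ((F.d (i - 1) i).hom.baseChange p.asIdeal.ResidueField)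
          ((F.d i (i + 1)).hom.baseChange p.asIdeal.ResidueField) := by
      rw [HomologicalComplex.exactAt_iff' _ (i - 1) i (i + 1) (by simp) (by simp),
        ShortComplex.ShortExact.moduleCat_exact_iff_function_exact]
      exact ModuleCat.function_exact_extendScalars_map_iff _ _
    refine ⟨fun h i _ => (hiff i).mp (h i), fun h i => ?_⟩
    by_cases hi : i ∈ Set.Icc m n
    · exact (hiff i).mpr (h i hi)
    · refine ShortComplex.exact_of_isZero_X₂ _ 
        (Functor.map_isZero (ModuleCat.extendScalars (algebraMap A (kappa A p))) (hmn i ?_))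
      rw [Set.mem_Icc] at hi
      omega
  rw [heq]
  refine (Set.finite_Icc m n).isOpen_biInter fun i _ => ?_
  have := (hF i).1
  have := (hF i).2
  have := (hF (i + 1)).1
  have := (hF (i + 1)).2
  refine isOpen_setOf_exact_baseChange_residueField ?_
  rw [← ModuleCat.hom_comp, F.d_comp_d, ModuleCat.hom_zero]

/-- Given a morphism `φ : P ⟶ Q` of perfect complexes over `A`, the set of primes `p` such
that `φ ⊗^L_A k(p)` is an isomorphism in `D(k(p))` (i.e. a quasi-isomorphism) is Zariski
open in `Spec A`. -/
theorem isOpen_fiberwise_iso (A : Type) [CommRing A]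
    (P Q : CochainComplex (ModuleCat.{0} A) ℤ)
    (hP : IsPerfectData A P) (hQ : IsPerfectData A Q) (φ : P ⟶ Q) :
    IsOpen {p : PrimeSpectrum A |
      QuasiIso (((ModuleCat.extendScalars
        (algebraMap A (kappa A p))).mapHomologicalComplex _).map φ)} := by
  have hadd (p : PrimeSpectrum A) : (ModuleCat.extendScalars (algebraMap A (kappa A p))).Additive :=
    (ModuleCat.extendRestrictScalarsAdj _).left_adjoint_additive
  simp_rw [CochainComplex.quasiIso_iff_acyclic_mappingCone]
  convert (hP.mappingCone hQ φ).isOpen_setOf_acyclic_extendScalars using 3 with p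
  exact forall_congr' fun i => exactAt_iff_of_quasiIsoAt
    (CochainComplex.mappingCone.mapHomologicalComplexIso φ
      (ModuleCat.extendScalars (algebraMap A (kappa A p)))).inv i
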